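/- arXiv:1507.07402 — 15 statements merged into one kernel-verified Lean document; each statement's English description precedes it below -/
import Mathlib

section
/- (Proposition 2.2) Suppose additionally that α > (−ln(1−σ))/σ, that 0 ≤ p i ≤ 1 for all i, and that for the constraint index k one has a k > 0 and ∑ i, A k i · x̂ i ≥ a k. Then the sum of f_k(Z) over all finsets Z of Fin n is at most s_k, and s_k < 1. -/
/-- Proposition 2.2: if `α > -ln(1-σ)/σ`, the probabilities `p_i = α x̂_i` lie in `[0,1]`,
`a_k > 0` and the fractional solution satisfies constraint `k`, then
`∑_{Z ⊆ [n]} f_k(Z) ≤ s_k` and `s_k < 1`, where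
`s_k = (1-σ)^{-a_k} exp(-σ α (A_k · x̂))`. -/
theorem sum_f_le_s_and_s_lt_one
    (n m : ℕ) (hn : 0 < n) (hm : 0 < m)
    (A : Fin m → Fin n → ℝ) (hA : ∀ k i, A k i ∈ Set.Icc (0 : ℝ) 1)
    (a : Fin m → ℝ) (xhat : Fin n → ℝ) (hxhat : ∀ i, 0 ≤ xhat i)
    (σ α : ℝ) (hσ0 : 0 < σ) (hσ1 : σ < 1) (hα : 0 < α)
    (hαbig : α > (-Real.log (1 - σ)) / σ)
    (hp : ∀ i, 0 ≤ α * xhat i ∧ α * xhat i ≤ 1)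
    (k : Fin m) (hak : 0 < a k)
    (hcov : ∑ i, A k i * xhat i ≥ a k) :
    (∑ Z : Finset (Fin n),
        ((1 - σ) ^ (-(a k)) * (∏ i, (1 - A k i * σ)) *
          ∏ i ∈ Z, ((1 - α * xhat i) * A k i * σ) / (1 - A k i * σ))
      ≤ (1 - σ) ^ (-(a k)) * Real.exp (-(σ * α * ∑ i, A k i * xhat i)))
    ∧ (1 - σ) ^ (-(a k)) * Real.exp (-(σ * α * ∑ i, A k i * xhat i)) < 1 := by
  have hAσ : ∀ i, 0 < 1 - A k i * σ := fun i => by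
    nlinarith [(hA k i).1, (hA k i).2]
  have hpos : 0 < (1 - σ) ^ (-(a k)) := Real.rpow_pos_of_pos (by linarith) _
  constructor
  · rw [← Finset.mul_sum, ← Finset.powerset_univ, ← Finset.prod_one_add, mul_assoc,
      ← Finset.prod_mul_distrib]
    refine mul_le_mul_of_nonneg_left ?_ hpos.le
    rw [Finset.mul_sum, ← Finset.sum_neg_distrib, Real.exp_sum]
    have hfactor : ∀ i, (1 - A k i * σ) *
        (1 + ((1 - α * xhat i) * A k i * σ) / (1 - A k i * σ)) =
          1 - A k i * σ * (α * xhat i) := fun i => by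
      have := (hAσ i).ne'
      field_simp
      ring
    refine Finset.prod_le_prod (fun i _ => ?_) fun i _ => ?_
    · rw [hfactor]
      nlinarith [hAσ i, mul_nonneg (hA k i).1 hσ0.le, (hp i).1, (hp i).2]
    · rw [hfactor]
      calc 1 - A k i * σ * (α * xhat i) = -(σ * α * (A k i * xhat i)) + 1 := by ring
        _ ≤ Real.exp (-(σ * α * (A k i * xhat i))) := Real.add_one_le_exp _
  · rw [Real.rpow_def_of_pos (by linarith), ← Real.exp_add, Real.exp_lt_one_iff]
    have hlog : -Real.log (1 - σ) < α * σ := (div_lt_iff₀ hσ0).1 hαbig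
    nlinarith [mul_lt_mul_of_pos_right hlog hak,
      mul_le_mul_of_nonneg_left hcov (mul_pos hσ0 hα).le]
end

section
/- (Proposition 2.3) Suppose additionally that 0 ≤ p i ≤ 1 for all i. Then for every constraint index k and every i : Fin n, the sum of f_k(Z) over all finsets Z of Fin n that contain i is at most s_k · A k i · σ. -/
/-- The subset expansion of a product, restricted to the subsets containing a fixed element. -/
theorem sum_mem_prod_mul_prod_div {ι : Type*} [Fintype ι] [DecidableEq ι] {K : Type*} [Field K]
    (b c : ι → K) (hc : ∀ j, c j ≠ 0) (i : ι) :
    ∑ Z ∈ Finset.univ.filter (fun Z : Finset ι => i ∈ Z), (∏ j, c j) * ∏ j ∈ Z, b j / c j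
      = b i * ∏ j ∈ Finset.univ.erase i, (b j + c j) := by
  have hexp : ∏ j, (b j + if j = i then 0 else c j)
      = b i * ∏ j ∈ Finset.univ.erase i, (b j + c j) := by
    rw [← Finset.mul_prod_erase Finset.univ _ (Finset.mem_univ i)]
    congr 1
    · simp
    · refine Finset.prod_congr rfl fun j hj => ?_
      rw [if_neg (Finset.ne_of_mem_erase hj)]
  rw [← hexp, Finset.prod_add, Finset.powerset_univ, Finset.sum_filter]
  refine Finset.sum_congr rfl fun Z _ => ?_
  split_ifs with hi
  · have hg : ∏ j ∈ Finset.univ \ Z, (if j = i then 0 else c j) = ∏ j ∈ Finset.univ \ Z, c j := by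
      refine Finset.prod_congr rfl fun j hj => if_neg ?_
      rintro rfl
      exact (Finset.mem_sdiff.1 hj).2 hi
    have hZ : ∏ j ∈ Z, c j ≠ 0 := Finset.prod_ne_zero_iff.2 fun j _ => hc j
    rw [hg, Finset.prod_div_distrib, ← Finset.prod_sdiff (Finset.subset_univ Z)]
    field_simp
  · have hi' : i ∈ Finset.univ \ Z := Finset.mem_sdiff.2 ⟨Finset.mem_univ i, hi⟩
    have hg : ∏ j ∈ Finset.univ \ Z, (if j = i then 0 else c j) = 0 :=
      Finset.prod_eq_zero hi' (if_pos rfl)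
    rw [hg, mul_zero]

/-- Proposition 2.3: assuming `p_i = α x̂_i ∈ [0,1]` for all `i`, for every constraint `k`
and every variable `i`, the sum of `f_k(Z)` over all sets `Z ∋ i` is at most
`s_k · A_{ki} · σ`, where `s_k = (1-σ)^{-a_k} exp(-σ α (A_k · x̂))`. -/
theorem sum_f_mem_le
    (n m : ℕ) (hn : 0 < n) (hm : 0 < m)
    (A : Fin m → Fin n → ℝ) (hA : ∀ k i, A k i ∈ Set.Icc (0 : ℝ) 1)
    (a : Fin m → ℝ) (xhat : Fin n → ℝ) (hxhat : ∀ i, 0 ≤ xhat i)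
    (σ α : ℝ) (hσ0 : 0 < σ) (hσ1 : σ < 1) (hα : 0 < α)
    (hp : ∀ i, 0 ≤ α * xhat i ∧ α * xhat i ≤ 1)
    (k : Fin m) (i : Fin n) :
    ∑ Z ∈ Finset.univ.filter (fun Z : Finset (Fin n) => i ∈ Z),
        ((1 - σ) ^ (-(a k)) * (∏ j, (1 - A k j * σ)) *
          ∏ j ∈ Z, ((1 - α * xhat j) * A k j * σ) / (1 - A k j * σ))
      ≤ ((1 - σ) ^ (-(a k)) * Real.exp (-(σ * α * ∑ j, A k j * xhat j))) * A k i * σ := by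
  have hAσ0 : ∀ j, 0 ≤ A k j * σ := fun j => mul_nonneg (hA k j).1 hσ0.le
  have hAσ1 : ∀ j, A k j * σ < 1 := fun j =>
    (mul_le_of_le_one_left hσ0.le (hA k j).2).trans_lt hσ1
  have hfactor : ∀ j, 0 ≤ (1 - α * xhat j) * A k j * σ + (1 - A k j * σ) ∧
      (1 - α * xhat j) * A k j * σ + (1 - A k j * σ)
        ≤ Real.exp (-(α * xhat j * (A k j * σ))) := by
    intro j
    have hle := mul_le_of_le_one_left (hAσ0 j) (hp j).2
    have hexp := Real.add_one_le_exp (-(α * xhat j * (A k j * σ)))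
    constructor <;> linarith [hAσ1 j]
  have hi : (1 - α * xhat i) * A k i * σ
      ≤ A k i * σ * Real.exp (-(α * xhat i * (A k i * σ))) := by
    have hle := mul_le_of_le_one_right (hp i).1 (hAσ1 i).le
    have hexp := Real.add_one_le_exp (-(α * xhat i * (A k i * σ)))
    have hmul : A k i * σ * (1 - α * xhat i)
        ≤ A k i * σ * Real.exp (-(α * xhat i * (A k i * σ))) :=
      mul_le_mul_of_nonneg_left (by linarith) (hAσ0 i)
    linarith
  have hexp_prod : Real.exp (-(σ * α * ∑ j, A k j * xhat j))
      = ∏ j, Real.exp (-(α * xhat j * (A k j * σ))) := by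
    rw [← Real.exp_sum, Finset.mul_sum, ← Finset.sum_neg_distrib]
    congr 1
    exact Finset.sum_congr rfl fun j _ => by ring
  simp_rw [mul_assoc ((1 - σ) ^ (-(a k)))]
  rw [← Finset.mul_sum, sum_mem_prod_mul_prod_div (fun j => (1 - α * xhat j) * A k j * σ)
    (fun j => 1 - A k j * σ) (fun j => (sub_pos.2 (hAσ1 j)).ne') i, hexp_prod,
    ← Finset.mul_prod_erase Finset.univ _ (Finset.mem_univ i)]
  calc
    _ ≤ (1 - σ) ^ (-(a k)) * (A k i * σ * Real.exp (-(α * xhat i * (A k i * σ))) *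
          ∏ j ∈ Finset.univ.erase i, Real.exp (-(α * xhat j * (A k j * σ)))) := by
      refine mul_le_mul_of_nonneg_left (mul_le_mul hi ?_ ?_ ?_)
        (Real.rpow_nonneg (sub_pos.2 hσ1).le _)
      · exact Finset.prod_le_prod (fun j _ => (hfactor j).1) fun j _ => (hfactor j).2
      · exact Finset.prod_nonneg fun j _ => (hfactor j).1
      · exact mul_nonneg (hAσ0 i) (Real.exp_pos _).le
    _ = _ := by ring
end

section
/- (Proposition 3.3) Let x̂ᵢ be a nonnegative real and let x'ᵢ ∈ {0,1} be any value satisfying: if x̂'ᵢ = 0 then x'ᵢ = 0. Then vᵢ + Gᵢ + x'ᵢ ≤ ⌈x̂ᵢ · (α·σ)/(−ln(1−σ))⌉, i.e. vᵢ + Gᵢ + x'ᵢ ≤ ⌈x̂ᵢ/θ⌉. -/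
/-- Proposition 3.3: with `θ = -ln(1-σ)/(ασ)`, `v = ⌊x̂/θ⌋`, `F = x̂ - vθ`,
`G = 1` iff `F ≥ 1/α` (else `0`), and `x̂' = 0` if `F ≥ 1/α` (else `F`), any
`x' ∈ {0,1}` satisfying `x̂' = 0 → x' = 0` obeys `v + G + x' ≤ ⌈x̂/θ⌉`
(note `(ασ)/(-ln(1-σ)) = 1/θ`). -/
theorem quantization_multiplicity
    (σ α : ℝ) (hσ0 : 0 < σ) (hσ1 : σ < 1) (hα : 1 ≤ α)
    (xi : ℝ) (hxi : 0 ≤ xi) :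
    let θ : ℝ := (-Real.log (1 - σ)) / (α * σ)
    let v : ℕ := ⌊xi / θ⌋₊
    let F : ℝ := xi - (v : ℝ) * θ
    let G : ℕ := if F ≥ 1 / α then 1 else 0
    let xhat' : ℝ := if F ≥ 1 / α then 0 else F
    ∀ x' : ℕ, x' ≤ 1 → (xhat' = 0 → x' = 0) →
      v + G + x' ≤ ⌈xi * (α * σ) / (-Real.log (1 - σ))⌉₊ := by
  intro θ v F G xhat' x' hx' hzero
  have hlog : 0 < -Real.log (1 - σ) := by
    have := Real.log_neg (sub_pos.mpr hσ1) (by linarith : 1 - σ < 1)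
    linarith
  have hα0 : 0 < α := by linarith
  have hθ : 0 < θ := div_pos hlog (mul_pos hα0 hσ0)
  rw [show xi * (α * σ) / (-Real.log (1 - σ)) = xi / θ from (div_div_eq_mul_div _ _ _).symm]
  have hv : (v : ℝ) ≤ xi / θ := Nat.floor_le (div_nonneg hxi hθ.le)
  have hF : 0 ≤ F := sub_nonneg.mpr ((le_div_iff₀ hθ).mp hv)
  have hinv : 0 < 1 / α := one_div_pos.mpr hα0
  have hpos (h : 0 < F) : v < ⌈xi / θ⌉₊ :=
    Nat.lt_ceil.mpr ((lt_div_iff₀ hθ).mpr (sub_pos.mp h))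
  by_cases hFα : F ≥ 1 / α
  · have hG : G = 1 := if_pos hFα
    have hx0 : x' = 0 := hzero (if_pos hFα)
    have := hpos (hinv.trans_le hFα)
    omega
  · have hG : G = 0 := if_neg hFα
    rcases hF.eq_or_lt with hF0 | hF0
    · have hx0 : x' = 0 := hzero ((if_neg hFα).trans hF0.symm)
      have : v ≤ ⌈xi / θ⌉₊ := Nat.floor_le_ceil _
      omega
    · have := hpos hF0
      omega
end

section
/- (Proposition 3.4) Let n be a positive integer, let A_k : Fin n → ℝ be a row of the constraint matrix with A_k i ∈ [0,1] for all i, let a_k be a real with ∑ i, A_k i · x̂ i ≥ a_k, where x̂ : Fin n → ℝ is nonnegative. Applying the quantization coordinatewise (yielding vᵢ, Gᵢ, x̂'ᵢ for each i), set a'_k := a_k − ∑ i, A_k i · (Gᵢ + vᵢ). Then (1−σ)^(a'_k) · exp(σ·α·∑ i, A_k i · x̂'ᵢ) ≥ (1−σ)^(a_k) · exp(σ·α·∑ i, A_k i · x̂ i) (real powers). -/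
/-- Proposition 3.4: applying the quantization coordinatewise and setting
`a'_k = a_k - ∑_i A_{ki}(G_i + v_i)`, we have
`(1-σ)^{a'_k} exp(σα ∑_i A_{ki} x̂'_i) ≥ (1-σ)^{a_k} exp(σα ∑_i A_{ki} x̂_i)`. -/
theorem residual_inflation_bound
    (σ α : ℝ) (hσ0 : 0 < σ) (hσ1 : σ < 1) (hα : 1 ≤ α)
    (n : ℕ) (hn : 0 < n)
    (Ak : Fin n → ℝ) (hAk : ∀ i, Ak i ∈ Set.Icc (0 : ℝ) 1)
    (ak : ℝ) (xhat : Fin n → ℝ) (hxhat : ∀ i, 0 ≤ xhat i)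
    (hcov : ∑ i, Ak i * xhat i ≥ ak) :
    let θ : ℝ := (-Real.log (1 - σ)) / (α * σ)
    let v : Fin n → ℕ := fun i => ⌊xhat i / θ⌋₊
    let F : Fin n → ℝ := fun i => xhat i - (v i : ℝ) * θ
    let G : Fin n → ℝ := fun i => if F i ≥ 1 / α then 1 else 0
    let xhat' : Fin n → ℝ := fun i => if F i ≥ 1 / α then 0 else F i
    let ak' : ℝ := ak - ∑ i, Ak i * (G i + (v i : ℝ))
    (1 - σ) ^ ak' * Real.exp (σ * α * ∑ i, Ak i * xhat' i)
      ≥ (1 - σ) ^ ak * Real.exp (σ * α * ∑ i, Ak i * xhat i) := by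
  intro θ v F G xhat' ak'
  have hL : 0 < -Real.log (1 - σ) :=
    neg_pos.2 (Real.log_neg (by linarith) (by linarith))
  have hασ : 0 < α * σ := by positivity
  have hθ : 0 < θ := div_pos hL hασ
  have hθL : α * σ * θ = -Real.log (1 - σ) := mul_div_cancel₀ _ hασ.ne'
  have coord_le (i : Fin n) :
      σ * α * xhat i ≤ -Real.log (1 - σ) * (G i + v i) + σ * α * xhat' i := by
    have hF : F i ≤ θ := by
      have h := (Nat.lt_floor_add_one (xhat i / θ)).le
      rw [div_le_iff₀ hθ] at h
      simp only [F, v]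
      linarith
    have hx : xhat i = F i + v i * θ := by simp only [F]; ring
    rw [← hθL, hx]
    by_cases h : F i ≥ 1 / α
    · simp only [G, xhat', if_pos h]
      linarith [mul_le_mul_of_nonneg_left hF hασ.le]
    · simp only [G, xhat', if_neg h]
      linarith
  have sum_le : σ * α * ∑ i, Ak i * xhat i ≤
      -Real.log (1 - σ) * ∑ i, Ak i * (G i + v i) + σ * α * ∑ i, Ak i * xhat' i := by
    simp only [Finset.mul_sum, ← Finset.sum_add_distrib]
    refine Finset.sum_le_sum fun i _ => ?_
    linarith [mul_le_mul_of_nonneg_left (coord_le i) (hAk i).1]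
  rw [ge_iff_le, Real.rpow_def_of_pos (by linarith), Real.rpow_def_of_pos (by linarith),
    ← Real.exp_add, ← Real.exp_add, Real.exp_le_exp]
  simp only [ak']
  linarith
end

section
/- (Theorem 4.2) Let n, m be positive integers, let A : Fin m → Fin n → ℝ have entries A k i ∈ [0,1], let a : Fin m → ℝ have a k > 0 for all k, and suppose Δ₁ := max over i of ∑ k, A k i is strictly positive. Then there exist A' : Fin m → Fin n → ℝ with entries in [0,1] and a' : Fin m → ℝ such that: (1) for every x : Fin n → ℕ, (∀ k, ∑ i, A k i · x i ≥ a k) if and only if (∀ k, ∑ i, A' k i · x i ≥ a' k); (2) a' k ≥ 1 for every k, and Δ₁' := max over i of ∑ k, A' k i satisfies Δ₁' ≥ 1; (3) ln(Δ₁' + 1)/(min over k of a' k) ≤ ln(Δ₁ + 1)/(min over k of a k). -/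
/-- Scaling property of the logarithm: `s * log (x / s + 1) ≤ log (x + 1)` for `s ∈ (0, 1]`. -/
theorem mul_log_div_add_one_le {s x : ℝ} (hs : 0 < s) (hs1 : s ≤ 1) (hx : 0 ≤ x) :
    s * Real.log (x / s + 1) ≤ Real.log (x + 1) := by
  have hpos : 0 < x / s + 1 := by positivity
  rw [← Real.log_rpow hpos]
  refine Real.log_le_log (by positivity) ?_
  have h := rpow_one_add_le_one_add_mul_self (s := x / s)
    (by linarith [hpos]) hs.le hs1
  rw [mul_div_cancel₀ x hs.ne'] at h
  rwa [add_comm (x / s), add_comm x]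

/-- Scaling a covering program up by `1 / s` with `s ∈ (0, 1]` does not increase
`log (Δ + 1) / b`. -/
theorem log_add_one_div_le_of_scaled {s D D' b b' : ℝ} (hs : 0 < s) (hs1 : s ≤ 1)
    (hD : 0 ≤ D) (hD' : 0 ≤ D') (hDD' : D' ≤ D / s) (hb : 0 < b) (hbb' : b / s ≤ b') :
    Real.log (D' + 1) / b' ≤ Real.log (D + 1) / b := by
  have hbs : 0 < b / s := by positivity
  calc Real.log (D' + 1) / b' ≤ Real.log (D / s + 1) / (b / s) := by
        have : 0 ≤ Real.log (D / s + 1) :=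
          Real.log_nonneg (le_add_of_nonneg_left (div_nonneg hD hs.le))
        gcongr
    _ = s * Real.log (D / s + 1) / b := by field_simp
    _ ≤ Real.log (D + 1) / b := by
        gcongr
        exact mul_log_div_add_one_le hs hs1 hD

/-- A covering constraint with right-hand side `b` has the same integral solutions after it is
divided by `min b 1` and its coefficients are truncated at `1`. -/
theorem covering_truncate_iff {ι : Type*} [Fintype ι] {u : ι → ℝ}
    (hu : ∀ i, u i ∈ Set.Icc (0 : ℝ) 1) {b : ℝ} (hb : 0 < b) (x : ι → ℕ) :
    b ≤ ∑ i, u i * (x i : ℝ) ↔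
      b / min b 1 ≤ ∑ i, min 1 (u i / min b 1) * (x i : ℝ) := by
  rcases le_total 1 b with h | h
  · simp [min_eq_right h, fun i => (hu i).2]
  rw [min_eq_left h, div_self hb.ne']
  by_cases hc : ∃ i, x i ≠ 0 ∧ b ≤ u i
  · obtain ⟨i, hi, hbi⟩ := hc
    have hxi : (1 : ℝ) ≤ x i := by exact_mod_cast Nat.one_le_iff_ne_zero.2 hi
    refine iff_of_true ?_ ?_
    · calc b ≤ u i * (x i : ℝ) := hbi.trans (le_mul_of_one_le_right (hu i).1 hxi)
        _ ≤ _ := Finset.single_le_sum (f := fun i => u i * (x i : ℝ))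
          (fun j _ => mul_nonneg (hu j).1 (Nat.cast_nonneg _)) (Finset.mem_univ i)
    · calc (1 : ℝ) ≤ min 1 (u i / b) * (x i : ℝ) := by
            rwa [min_eq_left ((one_le_div hb).2 hbi), one_mul]
        _ ≤ _ := Finset.single_le_sum (f := fun i => min 1 (u i / b) * (x i : ℝ))
          (fun j _ => mul_nonneg (le_min zero_le_one (div_nonneg (hu j).1 hb.le))
            (Nat.cast_nonneg _)) (Finset.mem_univ i)
  · push Not at hc
    have hsum : ∑ i, min 1 (u i / b) * (x i : ℝ) = (∑ i, u i * (x i : ℝ)) / b := by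
      rw [Finset.sum_div]
      refine Finset.sum_congr rfl fun i _ => ?_
      by_cases hi : x i = 0
      · simp [hi]
      · rw [min_eq_right ((div_le_one hb).2 (hc i hi).le), div_mul_eq_mul_div]
    rw [hsum, one_le_div hb]


/-- Theorem 4.2: any covering system `A, a` (entries in `[0,1]`, `a_k > 0`, `Δ₁ > 0`)
can be modified to an equivalent system `A', a'` with `a'_min ≥ 1`, `Δ₁' ≥ 1`, and
`ln(Δ₁'+1)/a'_min ≤ ln(Δ₁+1)/a_min`, having exactly the same integral solutions. -/
theorem cip_normalization
    (n m : ℕ) [NeZero n] [NeZero m]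
    (A : Fin m → Fin n → ℝ) (hA : ∀ k i, A k i ∈ Set.Icc (0 : ℝ) 1)
    (a : Fin m → ℝ) (ha : ∀ k, 0 < a k)
    (hΔ : 0 < Finset.univ.sup' Finset.univ_nonempty (fun i => ∑ k, A k i)) :
    ∃ (A' : Fin m → Fin n → ℝ) (a' : Fin m → ℝ),
      (∀ k i, A' k i ∈ Set.Icc (0 : ℝ) 1) ∧
      (∀ x : Fin n → ℕ,
        (∀ k, ∑ i, A k i * (x i : ℝ) ≥ a k) ↔ (∀ k, ∑ i, A' k i * (x i : ℝ) ≥ a' k)) ∧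
      (∀ k, a' k ≥ 1) ∧
      (1 ≤ Finset.univ.sup' Finset.univ_nonempty (fun i => ∑ k, A' k i)) ∧
      Real.log ((Finset.univ.sup' Finset.univ_nonempty (fun i => ∑ k, A' k i)) + 1) /
          (Finset.univ.inf' Finset.univ_nonempty (fun k => a' k))
        ≤ Real.log ((Finset.univ.sup' Finset.univ_nonempty (fun i => ∑ k, A k i)) + 1) /
          (Finset.univ.inf' Finset.univ_nonempty (fun k => a k)) := by
  set D := Finset.univ.sup' Finset.univ_nonempty (fun i => ∑ k, A k i) with hD
  set b := Finset.univ.inf' Finset.univ_nonempty a with hb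
  have hbk : ∀ k, b ≤ a k := fun k => Finset.inf'_le _ (Finset.mem_univ k)
  have hb0 : 0 < b := (Finset.lt_inf'_iff _).2 fun k _ => ha k
  have hr0 : ∀ k, 0 < min (a k) 1 := fun k => lt_min (ha k) one_pos
  have hs0 : 0 < min b 1 := lt_min hb0 one_pos
  have hdiv : ∀ t : ℝ, 0 < t → t / min t 1 = max 1 t := fun t ht => by
    rcases le_total 1 t with h | h
    · simp [h]
    · simp [h, ht.ne']
  let B : Fin m → Fin n → ℝ := fun k i => min 1 (A k i / min (a k) 1)
  have hAB : ∀ k i, A k i ≤ B k i := fun k i =>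
    le_min (hA k i).2 (le_div_self (hA k i).1 (hr0 k) (min_le_right _ _))
  have hB0 : ∀ k i, 0 ≤ B k i := fun k i => (hA k i).1.trans (hAB k i)
  set D' := Finset.univ.sup' Finset.univ_nonempty (fun i => ∑ k, B k i) with hD'
  have hBD' : ∀ i, ∑ k, B k i ≤ D' := fun i =>
    Finset.le_sup' (fun i => ∑ k, B k i) (Finset.mem_univ i)
  have hDD' : D ≤ D' := Finset.sup'_le _ _ fun i _ =>
    (Finset.sum_le_sum fun k _ => hAB k i).trans (hBD' i)
  have hD'0 : 0 < D' := hΔ.trans_le hDD'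
  have hD'le : D' ≤ D / min b 1 := by
    refine Finset.sup'_le _ _ fun i _ => ?_
    calc ∑ k, B k i ≤ ∑ k, A k i / min b 1 := Finset.sum_le_sum fun k _ =>
          (min_le_right _ _).trans
            (div_le_div_of_nonneg_left (hA k i).1 hs0 (min_le_min_right 1 (hbk k)))
      _ = (∑ k, A k i) / min b 1 := (Finset.sum_div _ _ _).symm
      _ ≤ D / min b 1 := by
          gcongr
          exact Finset.le_sup' (fun i => ∑ k, A k i) (Finset.mem_univ i)
  set d := min D' 1 with hd
  have hd0 : 0 < d := lt_min hD'0 one_pos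
  have hd1 : d ≤ 1 := min_le_right _ _
  have hBd : ∀ k i, B k i ≤ d := fun k i => le_min
    ((Finset.single_le_sum (f := fun k => B k i) (fun j _ => hB0 j i) (Finset.mem_univ k)).trans
      (hBD' i)) (min_le_left _ _)
  have hsup : Finset.univ.sup' Finset.univ_nonempty (fun i => ∑ k, B k i / d) = D' / d := by
    apply le_antisymm
    · refine Finset.sup'_le _ _ fun i _ => ?_
      rw [← Finset.sum_div]
      exact div_le_div_of_nonneg_right (hBD' i) hd0.le
    · obtain ⟨i, -, hi⟩ := Finset.exists_mem_eq_sup' (Finset.univ_nonempty (α := Fin n))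
        (fun i => ∑ k, B k i)
      rw [hD', hi, Finset.sum_div]
      exact Finset.le_sup' (fun i => ∑ k, B k i / d) (Finset.mem_univ i)
  refine ⟨fun k i => B k i / d, fun k => a k / min (a k) 1 / d, fun k i =>
    ⟨div_nonneg (hB0 k i) hd0.le, (div_le_one hd0).2 (hBd k i)⟩, fun x => forall_congr' fun k => ?_,
    fun k => ?_, ?_, ?_⟩
  · simp only [ge_iff_le, div_mul_eq_mul_div, ← Finset.sum_div, div_le_div_iff_of_pos_right hd0]
    simpa only [div_mul_eq_mul_div] using covering_truncate_iff (hA k) (ha k) x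
  · dsimp only
    rw [hdiv _ (ha k)]
    exact (one_le_div hd0).2 (hd1.trans (le_max_left _ _))
  · rw [hsup]
    exact (one_le_div hd0).2 (min_le_left _ _)
  · rw [hsup]
    calc _ ≤ Real.log (D' + 1) / (b / min b 1) := by
          refine log_add_one_div_le_of_scaled hd0 hd1 hD'0.le (by positivity) le_rfl
            (by positivity) ((Finset.le_inf'_iff _ _).2 fun k _ => ?_)
          dsimp only
          gcongr ?_ / d
          rw [hdiv _ hb0, hdiv _ (ha k)]
          exact max_le_max_left 1 (hbk k)
      _ ≤ Real.log (D + 1) / b :=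
          log_add_one_div_le_of_scaled hs0 (min_le_right _ _) hΔ.le hD'0.le hD'le hb0 le_rfl
end

section
/- (Key inequality in the proof of Theorem 5.1) For every real γ > 0 one has e^(γ + 2√γ) > (1 + √γ)², and moreover 1 + γ + 2√γ + ((e^γ − 1)·(γ + 2√γ)) / (e^(γ + 2√γ)/(1 + √γ)² − 1) ≤ 1 + γ + 4√γ. -/
theorem exp_mul_one_sub_le_one (x : ℝ) : Real.exp x * (1 - x) ≤ 1 := by
  calc Real.exp x * (1 - x) ≤ Real.exp x * Real.exp (-x) := by
        gcongr
        exact Real.one_sub_le_exp_neg x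
    _ = 1 := by rw [← Real.exp_add, add_neg_cancel, Real.exp_zero]

theorem cubic_le_exp_two_mul {s : ℝ} (hs : 0 ≤ s) :
    1 + 2 * s + 2 * s ^ 2 + s ^ 3 ≤ Real.exp (2 * s) := by
  have h := Real.sum_le_exp_of_nonneg (by positivity : 0 ≤ 2 * s) 4
  norm_num [Finset.sum_range_succ, Nat.factorial] at h
  nlinarith [pow_nonneg hs 3]

/-- Key inequality in the proof of Theorem 5.1: for all `γ > 0`,
`e^{γ + 2√γ} > (1+√γ)²` and
`1 + γ + 2√γ + (e^γ - 1)(γ + 2√γ) / (e^{γ+2√γ}/(1+√γ)² - 1) ≤ 1 + γ + 4√γ`. -/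
theorem key_inequality_th1 (γ : ℝ) (hγ : 0 < γ) :
    Real.exp (γ + 2 * Real.sqrt γ) > (1 + Real.sqrt γ) ^ 2 ∧
    1 + γ + 2 * Real.sqrt γ +
        ((Real.exp γ - 1) * (γ + 2 * Real.sqrt γ)) /
          (Real.exp (γ + 2 * Real.sqrt γ) / (1 + Real.sqrt γ) ^ 2 - 1)
      ≤ 1 + γ + 4 * Real.sqrt γ := by
  set s := √γ with hs
  have hs0 : 0 < s := Real.sqrt_pos.mpr hγ
  have hsq : γ = s ^ 2 := (Real.sq_sqrt hγ.le).symm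
  clear_value s
  subst hsq
  have hE : 1 < Real.exp (s ^ 2) := Real.one_lt_exp_iff.mpr hγ
  have hF := cubic_le_exp_two_mul hs0.le
  have hEF : Real.exp (s ^ 2 + 2 * s) = Real.exp (s ^ 2) * Real.exp (2 * s) := Real.exp_add _ _
  have hlt : (1 + s) ^ 2 < Real.exp (s ^ 2 + 2 * s) := by
    rw [hEF]
    nlinarith [pow_pos hs0 3]
  refine ⟨hlt, ?_⟩
  have hp : 0 < (1 + s) ^ 2 := by positivity
  have hden : 0 < Real.exp (s ^ 2 + 2 * s) / (1 + s) ^ 2 - 1 :=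
    sub_pos.mpr ((one_lt_div hp).mpr hlt)
  have hkey : (Real.exp (s ^ 2) - 1) * (s + 2) ≤
      2 * (Real.exp (s ^ 2 + 2 * s) / (1 + s) ^ 2 - 1) := by
    have hmul : (Real.exp (s ^ 2) - 1) * (s + 2) * (1 + s) ^ 2 + 2 * (1 + s) ^ 2 ≤
        2 * Real.exp (s ^ 2 + 2 * s) := by
      rw [hEF]
      nlinarith [mul_le_mul_of_nonneg_left hF (Real.exp_pos (s ^ 2)).le,
        mul_le_mul_of_nonneg_left (exp_mul_one_sub_le_one (s ^ 2)) hs0.le, pow_pos hs0 3]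
    have hdiv : (Real.exp (s ^ 2) - 1) * (s + 2) + 2 ≤
        2 * Real.exp (s ^ 2 + 2 * s) / (1 + s) ^ 2 := by
      rw [le_div_iff₀ hp]
      linarith
    rw [mul_div_assoc] at hdiv
    linarith
  have hfrac : (Real.exp (s ^ 2) - 1) * (s ^ 2 + 2 * s) /
      (Real.exp (s ^ 2 + 2 * s) / (1 + s) ^ 2 - 1) ≤ 2 * s := by
    rw [div_le_iff₀ hden]
    linarith [mul_le_mul_of_nonneg_left hkey hs0.le]
  linarith
end

section
/- (Key inequality in the proof of Theorem 5.2, small-γ case) For all reals ε and γ with 0 < ε ≤ 1 and 0 < γ ≤ ε²/2, one has (γ/2 + √γ) / ln(1 + √γ) ≤ 1 + ε. -/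
/-- Key inequality in the proof of Theorem 5.2 (small-γ case): for `0 < ε ≤ 1` and
`0 < γ ≤ ε²/2`, `(γ/2 + √γ)/ln(1 + √γ) ≤ 1 + ε`. -/
theorem key_inequality_th2_small (ε γ : ℝ) (hε0 : 0 < ε) (hε1 : ε ≤ 1)
    (hγ0 : 0 < γ) (hγ : γ ≤ ε ^ 2 / 2) :
    (γ / 2 + Real.sqrt γ) / Real.log (1 + Real.sqrt γ) ≤ 1 + ε := by
  have hs : 0 < Real.sqrt γ := Real.sqrt_pos.mpr hγ0
  have hsq : Real.sqrt γ ^ 2 = γ := Real.sq_sqrt hγ0.le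
  set s := Real.sqrt γ
  have hlog := Real.le_log_one_add_of_nonneg hs.le
  have hsε : 5 / 4 * s ≤ ε := by nlinarith
  have hquad : (s + 2) ^ 2 / 4 ≤ 1 + ε := by nlinarith
  rw [div_le_iff₀ (Real.log_pos (by linarith))]
  calc γ / 2 + s = (s + 2) ^ 2 / 4 * (2 * s / (s + 2)) := by
        rw [← hsq]; field_simp; ring
    _ ≤ (1 + ε) * Real.log (1 + s) := by gcongr
end

section
/- (Proposition 6.1, part 1) Let n, m be positive integers, A : Fin m → Fin n → ℝ with entries in [0,1], a : Fin m → ℝ, d : Fin n → ℕ, and X a finset of Fin n. For each k set v_k := a k − ∑ i ∈ X, A k i · d i; set a'_k := 0 if v_k ≤ 0, a'_k := 1 if 0 < v_k ≤ 1, and a'_k := v_k if v_k > 1; and set A'_{k i} := 0 if i ∈ X or v_k ≤ 0, A'_{k i} := min(1, A k i / v_k) if i ∉ X and 0 < v_k ≤ 1, and A'_{k i} := A k i if i ∉ X and v_k > 1. Then every x : Fin n → ℕ satisfying x i ≤ d i for all i and ∑ i, A k i · x i ≥ a k for all k also satisfies ∑ i, A'_{k i} · x i ≥ a'_k for all k.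 -/
/-- Truncating nonnegative coefficients at `1` preserves a covering constraint with right-hand
side `1` at integral points. -/
theorem one_le_sum_min_one_mul_natCast {ι : Type*} (s : Finset ι) (b : ι → ℝ) (x : ι → ℕ)
    (hb : ∀ i ∈ s, 0 ≤ b i) (h : 1 ≤ ∑ i ∈ s, b i * (x i : ℝ)) :
    1 ≤ ∑ i ∈ s, min 1 (b i) * (x i : ℝ) := by
  have hnonneg : ∀ i ∈ s, 0 ≤ min 1 (b i) * (x i : ℝ) := fun i hi =>
    mul_nonneg (le_min zero_le_one (hb i hi)) (Nat.cast_nonneg _)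
  by_cases hex : ∃ i ∈ s, 1 ≤ b i ∧ 1 ≤ x i
  · obtain ⟨i, hi, hbi, hxi⟩ := hex
    refine le_trans ?_ (Finset.single_le_sum hnonneg hi)
    rw [min_eq_left hbi, one_mul]
    exact_mod_cast hxi
  · push Not at hex
    refine h.trans (Finset.sum_le_sum fun i hi => ?_)
    rcases le_total 1 (b i) with hbi | hbi
    · have hx : x i = 0 := Nat.lt_one_iff.mp (hex i hi hbi)
      simp [hx]
    · rw [min_eq_right hbi]

/-- Pinning the variables in `s` to upper bounds leaves a valid covering constraint on the
remaining variables. -/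
theorem sub_sum_le_sum_compl {ι : Type*} [Fintype ι] [DecidableEq ι] (s : Finset ι)
    (c : ι → ℝ) (hc : ∀ i, 0 ≤ c i) (x d : ι → ℕ) (hxd : ∀ i, x i ≤ d i) (r : ℝ)
    (h : r ≤ ∑ i, c i * (x i : ℝ)) :
    r - ∑ i ∈ s, c i * (d i : ℝ) ≤ ∑ i ∈ sᶜ, c i * (x i : ℝ) := by
  have hle : ∑ i ∈ s, c i * (x i : ℝ) ≤ ∑ i ∈ s, c i * (d i : ℝ) :=
    Finset.sum_le_sum fun i _ => mul_le_mul_of_nonneg_left (by exact_mod_cast hxd i) (hc i)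
  have hsplit := Finset.sum_add_sum_compl s fun i => c i * (x i : ℝ)
  linarith

/-- Proposition 6.1 (part 1): every integral solution of the original CIP (respecting the
multiplicity constraints `x i ≤ d i`) is also a solution of the pinned-residual problem
`PR(X)`. -/
theorem pinned_residual_solution
    (n m : ℕ) (hn : 0 < n) (hm : 0 < m)
    (A : Fin m → Fin n → ℝ) (hA : ∀ k i, A k i ∈ Set.Icc (0 : ℝ) 1)
    (a : Fin m → ℝ) (d : Fin n → ℕ) (X : Finset (Fin n)) :
    let v : Fin m → ℝ := fun k => a k - ∑ i ∈ X, A k i * (d i : ℝ)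
    let a' : Fin m → ℝ := fun k => if v k ≤ 0 then 0 else if v k ≤ 1 then 1 else v k
    let A' : Fin m → Fin n → ℝ := fun k i =>
      if i ∈ X ∨ v k ≤ 0 then 0
      else if v k ≤ 1 then min 1 (A k i / v k)
      else A k i
    ∀ x : Fin n → ℕ, (∀ i, x i ≤ d i) → (∀ k, ∑ i, A k i * (x i : ℝ) ≥ a k) →
      ∀ k, ∑ i, A' k i * (x i : ℝ) ≥ a' k := by
  intro v a' A' x hxd hx k
  have hv : v k ≤ ∑ i ∈ Xᶜ, A k i * (x i : ℝ) :=
    sub_sum_le_sum_compl X (A k) (fun i => (hA k i).1) x d hxd (a k) (hx k)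
  have hsum : ∑ i, A' k i * (x i : ℝ) = ∑ i ∈ Xᶜ, A' k i * (x i : ℝ) := by
    refine (Finset.sum_subset (Finset.subset_univ _) fun i _ hi => ?_).symm
    have hiX : i ∈ X := by simpa using hi
    simp [A', hiX]
  rw [ge_iff_le, hsum]
  rcases le_or_gt (v k) 0 with h0 | h0
  · simp [a', A', h0]
  rcases le_or_gt (v k) 1 with h1 | h1
  · have ha : a' k = 1 := by simp [a', h0.not_ge, h1]
    have hA' : ∀ i ∈ Xᶜ, A' k i * (x i : ℝ) = min 1 (A k i / v k) * (x i : ℝ) := by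
      intro i hi
      simp [A', Finset.mem_compl.mp hi, h0.not_ge, h1]
    rw [ha, Finset.sum_congr rfl hA']
    refine one_le_sum_min_one_mul_natCast _ _ _ (fun i _ => div_nonneg (hA k i).1 h0.le) ?_
    simp_rw [div_mul_eq_mul_div]
    rwa [← Finset.sum_div, one_le_div h0]
  · have ha : a' k = v k := by simp [a', h0.not_ge, h1.not_ge]
    have hA' : ∀ i ∈ Xᶜ, A' k i * (x i : ℝ) = A k i * (x i : ℝ) := by
      intro i hi
      simp [A', Finset.mem_compl.mp hi, h0.not_ge, h1.not_ge]
    rwa [ha, Finset.sum_congr rfl hA']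
end

section
/- (Proposition 6.1, part 2) With the pinned-residual data as defined: for every k, either a'_k = 0 or a'_k ≥ 1; every entry A'_{k i} lies in [0,1]; and for every i, ∑ k, A'_{k i} ≤ the number of k with A k i > 0. In particular the maximum ℓ₁-column norm of A' is at most the maximum ℓ₀-column norm Δ₀ of A. -/
/-- Proposition 6.1 (part 2): in the pinned-residual problem `PR(X)`, every `a'_k` is `0`
or at least `1`, every entry of `A'` lies in `[0,1]`, each column `i` of `A'` has
`ℓ₁`-norm at most the number of constraints `k` with `A k i > 0`, and hence the maximum
`ℓ₁`-column norm of `A'` is at most the maximum `ℓ₀`-column norm `Δ₀` of `A`. -/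
theorem pinned_residual_params
    (n m : ℕ) [NeZero n] [NeZero m]
    (A : Fin m → Fin n → ℝ) (hA : ∀ k i, A k i ∈ Set.Icc (0 : ℝ) 1)
    (a : Fin m → ℝ) (d : Fin n → ℕ) (X : Finset (Fin n)) :
    let v : Fin m → ℝ := fun k => a k - ∑ i ∈ X, A k i * (d i : ℝ)
    let a' : Fin m → ℝ := fun k => if v k ≤ 0 then 0 else if v k ≤ 1 then 1 else v k
    let A' : Fin m → Fin n → ℝ := fun k i =>
      if i ∈ X ∨ v k ≤ 0 then 0
      else if v k ≤ 1 then min 1 (A k i / v k)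
      else A k i
    (∀ k, a' k = 0 ∨ a' k ≥ 1) ∧
    (∀ k i, A' k i ∈ Set.Icc (0 : ℝ) 1) ∧
    (∀ i, ∑ k, A' k i ≤ ((Finset.univ.filter (fun k => 0 < A k i)).card : ℝ)) ∧
    Finset.univ.sup' Finset.univ_nonempty (fun i => ∑ k, A' k i)
      ≤ ((Finset.univ.sup' Finset.univ_nonempty
            (fun i => (Finset.univ.filter (fun k => 0 < A k i)).card) : ℕ) : ℝ) := by
  intro v a' A'
  have entry_mem : ∀ k i, A' k i ∈ Set.Icc (0 : ℝ) 1 := by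
    intro k i
    obtain ⟨h0, h1⟩ := hA k i
    simp only [A']
    split_ifs with h hv
    · simp
    · have hpos : 0 < v k := not_le.mp fun hle => h (Or.inr hle)
      exact ⟨le_min zero_le_one (div_nonneg h0 hpos.le), min_le_left _ _⟩
    · exact ⟨h0, h1⟩
  have entry_eq_zero : ∀ k i, ¬ 0 < A k i → A' k i = 0 := by
    intro k i h
    have hz : A k i = 0 := le_antisymm (not_lt.mp h) (hA k i).1
    simp [A', hz]
  have column_le : ∀ i, ∑ k, A' k i ≤
      ((Finset.univ.filter (fun k => 0 < A k i)).card : ℝ) := by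
    intro i
    rw [← Finset.sum_boole]
    refine Finset.sum_le_sum fun k _ => ?_
    split_ifs with h
    · exact (entry_mem k i).2
    · exact (entry_eq_zero k i h).le
  refine ⟨fun k => ?_, entry_mem, column_le, ?_⟩
  · simp only [a']
    split_ifs with h0 h1
    · exact Or.inl rfl
    · exact Or.inr le_rfl
    · exact Or.inr (not_le.mp h1).le
  · refine Finset.sup'_le _ _ fun i _ => (column_le i).trans ?_
    exact_mod_cast Finset.le_sup' (fun i => (Finset.univ.filter (fun k => 0 < A k i)).card)
      (Finset.mem_univ i)
end

section
/- (Counting lemma underlying the proof of Proposition 7.2) Let n, m, s, t be positive integers with s + t ≤ n, and suppose (∑_{r=0}^{t} C(n,r)) · (1 − C(n−t, s)/C(n, s))^m < 1, where C(·,·) denotes the binomial coefficient. Then there exist finsets S₁, …, S_m of Fin n, each of cardinality s, such that for every finset I of Fin n with |I| ≤ t there is some k with S_k ∩ I = ∅. -/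
/-- The union bound, by counting: if each `y ∈ B` is missed by at most `b` elements of `A` and
`#B * b ^ m < #A ^ m`, then some `m` elements of `A` together hit every `y ∈ B`. -/
theorem exists_fun_forall_exists_of_card_mul_pow_lt {α β : Type*} (A : Finset α) (B : Finset β)
    (r : α → β → Prop) [∀ x y, Decidable (r x y)] {b m : ℕ}
    (hb : ∀ y ∈ B, (A.filter fun x => ¬ r x y).card ≤ b)
    (hlt : B.card * b ^ m < A.card ^ m) :
    ∃ f : Fin m → α, (∀ k, f k ∈ A) ∧ ∀ y ∈ B, ∃ k, r (f k) y := by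
  classical
  by_contra! h
  have hsub : Fintype.piFinset (fun _ : Fin m => A) ⊆
      B.biUnion fun y => Fintype.piFinset fun _ : Fin m => A.filter fun x => ¬ r x y := by
    intro f hf
    rw [Fintype.mem_piFinset] at hf
    obtain ⟨y, hy, hfy⟩ := h f hf
    simp only [Finset.mem_biUnion, Fintype.mem_piFinset, Finset.mem_filter]
    exact ⟨y, hy, fun k => ⟨hf k, hfy k⟩⟩
  have hcard := (Finset.card_le_card hsub).trans <| Finset.card_biUnion_le_card_mul _ _ (b ^ m)
    fun y hy => by
      simpa [Fintype.card_piFinset] using Nat.pow_le_pow_left (hb y hy) m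
  simp only [Fintype.card_piFinset, Finset.prod_const, Finset.card_univ, Fintype.card_fin] at hcard
  omega

/-- The number of `s`-subsets disjoint from a given set. -/
theorem card_filter_disjoint_powersetCard_univ {α : Type*} [Fintype α] [DecidableEq α]
    (s : ℕ) (I : Finset α) :
    ((Finset.powersetCard s Finset.univ).filter fun S => Disjoint S I).card =
      (Fintype.card α - I.card).choose s := by
  have h : (Finset.powersetCard s Finset.univ).filter (fun S => Disjoint S I) =
      Finset.powersetCard s Iᶜ := by
    ext S
    simp [Finset.mem_powersetCard, Finset.subset_compl_iff_disjoint_right, and_comm]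
  rw [h, Finset.card_powersetCard, Finset.card_compl]

/-- The number of subsets with at most `t` elements. -/
theorem card_filter_card_le {α : Type*} [Fintype α] (t : ℕ) :
    ((Finset.univ : Finset (Finset α)).filter fun I => I.card ≤ t).card =
      ∑ r ∈ Finset.range (t + 1), (Fintype.card α).choose r := by
  classical
  rw [Finset.card_eq_sum_card_fiberwise (f := Finset.card) (t := Finset.range (t + 1))
    fun I hI => by simpa [Nat.lt_succ_iff] using hI]
  refine Finset.sum_congr rfl fun r hr => ?_
  rw [← Finset.card_univ, ← Finset.card_powersetCard]
  congr 1
  ext I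
  simp only [Finset.mem_range] at hr
  simp only [Finset.mem_filter, Finset.mem_univ, true_and, Finset.mem_powersetCard,
    Finset.subset_univ, and_iff_right_iff_imp]
  omega


/-- Counting lemma underlying the proof of Proposition 7.2: if
`(∑_{r=0}^{t} C(n,r)) · (1 - C(n-t,s)/C(n,s))^m < 1`, then there exist `s`-element
subsets `S₁, …, S_m` of `[n]` such that every set `I` of at most `t` variables is
disjoint from some `S_k` (so no integral solution supported on at most `t` variables
satisfies all `m` covering constraints). -/
theorem existence_of_hard_instance
    (n m s t : ℕ) (hn : 0 < n) (hm : 0 < m) (hs : 0 < s) (ht : 0 < t)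
    (hst : s + t ≤ n)
    (hprob : (∑ r ∈ Finset.range (t + 1), (n.choose r : ℝ)) *
        (1 - ((n - t).choose s : ℝ) / (n.choose s : ℝ)) ^ m < 1) :
    ∃ S : Fin m → Finset (Fin n),
      (∀ k, (S k).card = s) ∧
      ∀ I : Finset (Fin n), I.card ≤ t → ∃ k, S k ∩ I = ∅ := by
  have hN : 0 < n.choose s := Nat.choose_pos (by omega)
  have hMN : (n - t).choose s ≤ n.choose s := Nat.choose_le_choose s (Nat.sub_le n t)
  have hlt : (∑ r ∈ Finset.range (t + 1), n.choose r) * (n.choose s - (n - t).choose s) ^ m <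
      n.choose s ^ m := by
    have hN' : (0 : ℝ) < n.choose s := by exact_mod_cast hN
    rw [one_sub_div hN'.ne', div_pow, ← mul_div_assoc, div_lt_one (pow_pos hN' m),
      ← Nat.cast_sub hMN] at hprob
    exact_mod_cast hprob
  obtain ⟨S, hS, hSI⟩ := exists_fun_forall_exists_of_card_mul_pow_lt
    (Finset.powersetCard s (Finset.univ : Finset (Fin n)))
    (Finset.univ.filter fun I : Finset (Fin n) => I.card ≤ t) Disjoint
    (b := n.choose s - (n - t).choose s) (m := m)
    (fun I hI => by
      have hsum := Finset.card_filter_add_card_filter_not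
        (s := Finset.powersetCard s (Finset.univ : Finset (Fin n))) (fun S => Disjoint S I)
      rw [card_filter_disjoint_powersetCard_univ, Finset.card_powersetCard, Finset.card_univ,
        Fintype.card_fin] at hsum
      have hle : (n - t).choose s ≤ (n - I.card).choose s :=
        Nat.choose_le_choose s (Nat.sub_le_sub_left (Finset.mem_filter.mp hI).2 n)
      omega)
    (by simpa [card_filter_card_le] using hlt)
  refine ⟨S, fun k => (Finset.mem_powersetCard.mp (hS k)).2, fun I hI => ?_⟩
  obtain ⟨k, hk⟩ := hSI I (by simpa using hI)
  exact ⟨k, Finset.disjoint_iff_inter_eq_empty.mp hk⟩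
end

section
/- (Double-counting lemma in the proof of Proposition 7.4) Let q, T, a be positive integers with a ≤ T and q ≥ 2, and let y : Fin T → (Fin q → ZMod 2) be a list of nonzero vectors over GF(2) (repetitions allowed). Suppose that for every nonzero vector k : Fin q → ZMod 2, the number of indices j with the GF(2) inner product ∑ l, k l · (y j) l equal to 0 is at most T − a. Then C(T, q−1) ≤ (2^q − 1) · C(T − a, q−1), where C(·,·) denotes the binomial coefficient. -/
/-- Fewer than `q` vectors of `K^q` admit a common nonzero orthogonal vector. -/
theorem exists_ne_zero_forall_sum_mul_eq_zero {K ι : Type*} [Field K] {q : ℕ}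
    (y : ι → Fin q → K) (s : Finset ι) (hs : s.card < q) :
    ∃ k : Fin q → K, k ≠ 0 ∧ ∀ j ∈ s, ∑ l, k l * y j l = 0 := by
  let f := Matrix.mulVecLin (Matrix.of fun j : s => y j)
  have hf : LinearMap.ker f ≠ ⊥ := LinearMap.ker_ne_bot_of_finrank_lt (by simpa using hs)
  obtain ⟨k, hk, hk0⟩ := (Submodule.ne_bot_iff _).1 hf
  refine ⟨k, hk0, fun j hj => ?_⟩
  have h := congrFun (LinearMap.mem_ker.1 hk) ⟨j, hj⟩
  simpa [f, Matrix.mulVec, dotProduct, mul_comm] using h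

/-- Double-counting lemma in the proof of Proposition 7.4: if `y₁, …, y_T` are nonzero
vectors of `GF(2)^q` such that every nonzero `k ∈ GF(2)^q` is orthogonal to at most
`T - a` of them, then `C(T, q-1) ≤ (2^q - 1) · C(T-a, q-1)`. -/
theorem double_counting_lemma
    (q T a : ℕ) (hq : 2 ≤ q) (hT : 0 < T) (ha : 0 < a) (haT : a ≤ T)
    (y : Fin T → (Fin q → ZMod 2)) (hy : ∀ j, y j ≠ 0)
    (horth : ∀ k : Fin q → ZMod 2, k ≠ 0 →
      (Finset.univ.filter (fun j => ∑ l, k l * y j l = 0)).card ≤ T - a) :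
    T.choose (q - 1) ≤ (2 ^ q - 1) * (T - a).choose (q - 1) := by
  classical
  let N : (Fin q → ZMod 2) → Finset (Fin T) := fun k =>
    Finset.univ.filter fun j => ∑ l, k l * y j l = 0
  let K : Finset (Fin q → ZMod 2) := Finset.univ.erase 0
  have hK : K.card = 2 ^ q - 1 := by simp [K, Finset.card_erase_of_mem]
  have hcover : Finset.univ.powersetCard (q - 1) ⊆
      K.biUnion fun k => (N k).powersetCard (q - 1) := by
    intro s hs
    have hcard := (Finset.mem_powersetCard.1 hs).2
    obtain ⟨k, hk0, hk⟩ := exists_ne_zero_forall_sum_mul_eq_zero y s (by omega)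
    refine Finset.mem_biUnion.2 ⟨k, by simpa [K] using hk0, ?_⟩
    exact Finset.mem_powersetCard.2 ⟨fun j hj => by simpa [N] using hk j hj, hcard⟩
  calc T.choose (q - 1) = (Finset.univ.powersetCard (q - 1) : Finset (Finset (Fin T))).card := by
        simp
    _ ≤ (K.biUnion fun k => (N k).powersetCard (q - 1)).card := Finset.card_le_card hcover
    _ ≤ K.card * (T - a).choose (q - 1) := by
        refine Finset.card_biUnion_le_card_mul _ _ _ fun k hk => ?_
        rw [Finset.card_powersetCard]
        exact Nat.choose_le_choose _ (horth k (Finset.ne_of_mem_erase hk))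
    _ = (2 ^ q - 1) * (T - a).choose (q - 1) := by rw [hK]
end

section
/- (Proposition A.1) Let S be a finset of a type ι, let x : ι → ℝ satisfy 0 ≤ x i ≤ 1 for all i ∈ S, and let a ∈ (0,1) be a real. Then ∏ i ∈ S, (1 − a·x i)⁻¹ ≤ (1 − a)^(−∑ i ∈ S, x i), where the right-hand side is a real power. -/
/-- Proposition A.1: for `x i ∈ [0,1]` on `S` and `a ∈ (0,1)`,
`∏_{i ∈ S} (1 - a x i)⁻¹ ≤ (1-a)^{-∑_{i ∈ S} x i}` (real power). -/
theorem prod_inv_le_rpow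
    {ι : Type*} (S : Finset ι) (x : ι → ℝ)
    (hx : ∀ i ∈ S, 0 ≤ x i ∧ x i ≤ 1)
    (a : ℝ) (ha : a ∈ Set.Ioo (0 : ℝ) 1) :
    ∏ i ∈ S, (1 - a * x i)⁻¹ ≤ (1 - a) ^ (-(∑ i ∈ S, x i)) := by
  obtain ⟨ha0, ha1⟩ := ha
  have hpos : 0 < 1 - a := sub_pos.mpr ha1
  rw [Real.rpow_neg hpos.le, Real.rpow_sum_of_pos hpos, ← Finset.prod_inv_distrib]
  have bernoulli : ∀ i ∈ S, (1 - a) ^ x i ≤ 1 - a * x i := fun i hi => by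
    have h := rpow_one_add_le_one_add_mul_self (s := -a) (by linarith) (hx i hi).1 (hx i hi).2
    rwa [← sub_eq_add_neg, mul_neg, ← sub_eq_add_neg, mul_comm] at h
  refine Finset.prod_le_prod (fun i hi => ?_) fun i hi => ?_
  · exact inv_nonneg.mpr ((Real.rpow_nonneg hpos.le _).trans (bernoulli i hi))
  · exact inv_anti₀ (Real.rpow_pos_of_pos hpos _) (bernoulli i hi)
end

section
/- (Proposition A.3) Let γ > 0 be a real and set c := (2√γ + γ − 2·ln(1 + √γ))/γ. Then the function f(x) := x/((x+1)^c − 1) (real power) is strictly decreasing on (0,∞): for all reals 0 < x₁ < x₂ one has f(x₂) < f(x₁). -/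
theorem div_rpow_add_one_sub_one_lt {p x y : ℝ} (hp : 1 < p) (hx : 0 < x) (hxy : x < y) :
    y / ((y + 1) ^ p - 1) < x / ((x + 1) ^ p - 1) := by
  have secant := (strictConvexOn_rpow hp).secant_strict_mono_aux2 (x := 1) (y := x + 1)
    (z := y + 1) (Set.mem_Ici.2 zero_le_one) (Set.mem_Ici.2 (by linarith)) (by linarith)
    (by linarith)
  simp only [Real.one_rpow, add_sub_cancel_right] at secant
  have hpos : 0 < (x + 1) ^ p - 1 :=
    sub_pos.2 (Real.one_lt_rpow (by linarith) (by linarith))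
  simpa only [inv_div] using inv_strictAnti₀ (div_pos hpos hx) secant

theorem one_lt_exponent {γ : ℝ} (hγ : 0 < γ) :
    1 < (2 * Real.sqrt γ + γ - 2 * Real.log (1 + Real.sqrt γ)) / γ := by
  have hs : 0 < Real.sqrt γ := Real.sqrt_pos.2 hγ
  have hlog := Real.log_lt_sub_one_of_pos (x := 1 + Real.sqrt γ) (by linarith) (by linarith)
  rw [one_lt_div hγ]
  linarith

/-- Proposition A.3: with `c = (2√γ + γ - 2 ln(1+√γ))/γ` for `γ > 0`, the function
`f(x) = x/((x+1)^c - 1)` is strictly decreasing on `(0,∞)`. -/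
theorem f_strict_anti (γ : ℝ) (hγ : 0 < γ) :
    let c : ℝ := (2 * Real.sqrt γ + γ - 2 * Real.log (1 + Real.sqrt γ)) / γ
    ∀ x₁ x₂ : ℝ, 0 < x₁ → x₁ < x₂ →
      x₂ / ((x₂ + 1) ^ c - 1) < x₁ / ((x₁ + 1) ^ c - 1) := by
  intro c x₁ x₂ hx₁ hx
  exact div_rpow_add_one_sub_one_lt (one_lt_exponent hγ) hx₁ hx
end

section
/- (Proposition A.4) For all reals μ, μ', t with 0 < μ ≤ μ' ≤ t, one has ChernoffU(μ, t) ≤ ChernoffU(μ', t). -/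
/-- The Chernoff upper-tail bound: `ChernoffU(μ,t) = (e^δ/(1+δ)^{1+δ})^μ` with
`δ = t/μ - 1` (real powers). -/
noncomputable def ChernoffU (μ t : ℝ) : ℝ :=
  (Real.exp (t / μ - 1) / (1 + (t / μ - 1)) ^ (1 + (t / μ - 1))) ^ μ

theorem chernoffU_eq_exp {μ t : ℝ} (hμ : 0 < μ) (ht : 0 < t) :
    ChernoffU μ t = Real.exp (t - μ - t * (Real.log t - Real.log μ)) := by
  have hr : 0 < t / μ := div_pos ht hμ
  rw [ChernoffU, add_sub_cancel, Real.rpow_def_of_pos hr, ← Real.exp_sub, ← Real.exp_mul,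
    Real.log_div ht.ne' hμ.ne']
  congr 1
  field_simp

/-- Proposition A.4: `ChernoffU(μ, t)` is monotone increasing in `μ` for
`0 < μ ≤ μ' ≤ t`. -/
theorem chernoffU_mono_mu (μ μ' t : ℝ) (hμ : 0 < μ) (hμμ' : μ ≤ μ') (hμ't : μ' ≤ t) :
    ChernoffU μ t ≤ ChernoffU μ' t := by
  have hμ' : 0 < μ' := hμ.trans_le hμμ'
  have ht : 0 < t := hμ'.trans_le hμ't
  rw [chernoffU_eq_exp hμ ht, chernoffU_eq_exp hμ' ht, Real.exp_le_exp]
  have hlog : Real.log μ - Real.log μ' ≤ μ / μ' - 1 := by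
    rw [← Real.log_div hμ.ne' hμ'.ne']
    exact Real.log_le_sub_one_of_pos (div_pos hμ hμ')
  have hmono : Real.log μ ≤ Real.log μ' := Real.log_le_log hμ hμμ'
  have hdiff : μ' - μ ≤ μ' * (Real.log μ' - Real.log μ) := by
    calc μ' - μ = μ' * (1 - μ / μ') := by field_simp
      _ ≤ μ' * (Real.log μ' - Real.log μ) :=
        mul_le_mul_of_nonneg_left (by linarith) hμ'.le
  have hscale : μ' * (Real.log μ' - Real.log μ) ≤ t * (Real.log μ' - Real.log μ) :=
    mul_le_mul_of_nonneg_right hμ't (sub_nonneg.mpr hmono)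
  linarith
end

section
/- (Proposition A.6) For every real g with 0 < g < 1, define f₁(g) := 2g·(−2 + ln(4−3g) − ln(8−3g) − ln(g+4) + ln(g+8) − 2·ln 2) and f₂(g) := 4g·ln 2 − (4−3g)·ln(4−3g) + (8−3g)·ln(8−3g) + (4+g)·ln(4+g) − (8+g)·ln(8+g). Then f₂(g) < 0 and 14/g > 1 + f₁(g)/f₂(g). -/
theorem nonpos_of_hasDerivAt_nonpos {F F' : ℝ → ℝ}
    (h0 : F 0 = 0) (hF : ∀ x ∈ Set.Icc (0 : ℝ) 1, HasDerivAt F (F' x) x)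
    (hF' : ∀ x ∈ Set.Icc (0 : ℝ) 1, F' x ≤ 0) :
    ∀ x ∈ Set.Icc (0 : ℝ) 1, F x ≤ 0 := by
  intro x hx
  have hanti : AntitoneOn F (Set.Icc 0 1) := by
    refine antitoneOn_of_deriv_nonpos (convex_Icc 0 1)
      (fun y hy => (hF y hy).continuousAt.continuousWithinAt)
      (fun y hy => (hF y (interior_subset hy)).differentiableAt.differentiableWithinAt) ?_
    intro y hy
    rw [(hF y (interior_subset hy)).deriv]
    exact hF' y (interior_subset hy)
  simpa [h0] using hanti (Set.left_mem_Icc.2 zero_le_one) hx hx.1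

theorem hasDerivAt_log_affine (a b x : ℝ) (h : a + b * x ≠ 0) :
    HasDerivAt (fun y => Real.log (a + b * y)) (b / (a + b * x)) x := by
  simpa using (((hasDerivAt_id x).const_mul b).const_add a).log h

theorem hasDerivAt_mul_log_affine (a b x : ℝ) (h : a + b * x ≠ 0) :
    HasDerivAt (fun y => (a + b * y) * Real.log (a + b * y))
      (b * Real.log (a + b * x) + b) x := by
  have hl := ((hasDerivAt_id x).const_mul b).const_add a
  refine (hl.mul (hasDerivAt_log_affine a b x h)).congr_deriv ?_
  rw [mul_one, id, mul_div_cancel₀ _ h]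

theorem div_sub_div_of_eq_add_four {a b : ℝ} (c : ℝ) (ha : a ≠ 0) (hb : b ≠ 0)
    (hab : b = a + 4) : c / a - c / b = 4 * c / (a * b) := by
  rw [div_sub_div _ _ ha hb, hab]
  ring

theorem log_four : Real.log 4 = 2 * Real.log 2 := by
  rw [show (4 : ℝ) = 2 ^ 2 by norm_num, Real.log_pow]
  norm_num

theorem log_eight : Real.log 8 = 3 * Real.log 2 := by
  rw [show (8 : ℝ) = 2 ^ 3 by norm_num, Real.log_pow]
  norm_num

theorem log_ratio_lower_bound : ∀ x ∈ Set.Icc (0 : ℝ) 1,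
    -(1 / 2 * x + 9 / 40 * x ^ 2 + 2 / 5 * x ^ 4)
      - (Real.log (4 + -3 * x) - Real.log (8 + -3 * x)
        - Real.log (4 + 1 * x) + Real.log (8 + 1 * x)) ≤ 0 := by
  refine nonpos_of_hasDerivAt_nonpos
    (F' := fun x => -(1 / 2 + 9 / 20 * x + 8 / 5 * x ^ 3)
      - (-3 / (4 + -3 * x) - -3 / (8 + -3 * x) - 1 / (4 + 1 * x) + 1 / (8 + 1 * x))) ?_ ?_ ?_
  · norm_num
  · rintro x ⟨hx0, hx1⟩
    have hpoly : HasDerivAt (fun x : ℝ => 1 / 2 * x + 9 / 40 * x ^ 2 + 2 / 5 * x ^ 4)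
        (1 / 2 + 9 / 20 * x + 8 / 5 * x ^ 3) x := by
      refine ((((hasDerivAt_id x).const_mul (1 / 2)).add
        ((hasDerivAt_pow 2 x).const_mul (9 / 40))).add
        ((hasDerivAt_pow 4 x).const_mul (2 / 5))).congr_deriv ?_
      norm_num
      ring
    exact hpoly.neg.sub ((((hasDerivAt_log_affine 4 (-3) x (by linarith)).sub
      (hasDerivAt_log_affine 8 (-3) x (by linarith))).sub
      (hasDerivAt_log_affine 4 1 x (by linarith))).add
      (hasDerivAt_log_affine 8 1 x (by linarith)))
  · rintro x ⟨hx0, hx1⟩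
    have h1 : 0 < 4 + -3 * x := by linarith
    have h2 : 0 < 8 + -3 * x := by linarith
    have h3 : 0 < 4 + 1 * x := by linarith
    have h4 : 0 < 8 + 1 * x := by linarith
    have d1 := div_sub_div_of_eq_add_four (-3) h1.ne' h2.ne' (by ring)
    have d2 := div_sub_div_of_eq_add_four 1 h3.ne' h4.ne' (by ring)
    have hsum : 12 / ((4 + -3 * x) * (8 + -3 * x)) + 4 / ((4 + 1 * x) * (8 + 1 * x))
        ≤ 1 / 2 + 9 / 20 * x + 8 / 5 * x ^ 3 := by
      rw [div_add_div _ _ (by positivity) (by positivity), div_le_iff₀ (by positivity)]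
      have hy : 0 ≤ 1 - x := sub_nonneg.2 hx1
      have b1 : 0 ≤ x * (1 - x) ^ 6 := by positivity
      have b2 : 0 ≤ x ^ 2 * (1 - x) ^ 5 := by positivity
      have b3 : 0 ≤ x ^ 3 * (1 - x) ^ 4 := by positivity
      have b4 : 0 ≤ x ^ 4 * (1 - x) ^ 3 := by positivity
      have b5 : 0 ≤ x ^ 5 * (1 - x) ^ 2 := by positivity
      have b6 : 0 ≤ x ^ 6 * (1 - x) := by positivity
      have b7 : 0 ≤ x ^ 7 := by positivity
      linarith
    have e : -(12 / ((4 + -3 * x) * (8 + -3 * x))) = 4 * -3 / ((4 + -3 * x) * (8 + -3 * x)) := by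
      ring
    norm_num only at d1 d2 hsum e ⊢
    linarith

theorem entropy_deriv_upper_bound : ∀ x ∈ Set.Icc (0 : ℝ) 1,
    4 * Real.log 2 - (-3 * Real.log (4 + -3 * x) + -3) + (-3 * Real.log (8 + -3 * x) + -3)
      + (1 * Real.log (4 + 1 * x) + 1) - (1 * Real.log (8 + 1 * x) + 1)
      + (x + 3 / 5 * x ^ 2) ≤ 0 := by
  refine nonpos_of_hasDerivAt_nonpos
    (F' := fun x => - (-3 * (-3 / (4 + -3 * x))) + -3 * (-3 / (8 + -3 * x))
      + 1 * (1 / (4 + 1 * x)) - 1 * (1 / (8 + 1 * x)) + (1 + 6 / 5 * x)) ?_ ?_ ?_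
  · norm_num [log_four, log_eight]
    ring
  · rintro x ⟨hx0, hx1⟩
    have hpoly : HasDerivAt (fun x : ℝ => x + 3 / 5 * x ^ 2) (1 + 6 / 5 * x) x := by
      refine ((hasDerivAt_id x).add ((hasDerivAt_pow 2 x).const_mul (3 / 5))).congr_deriv ?_
      norm_num
      ring
    exact (((((((hasDerivAt_log_affine 4 (-3) x (by linarith)).const_mul (-3)).add_const
      (-3)).const_sub (4 * Real.log 2)).add
      (((hasDerivAt_log_affine 8 (-3) x (by linarith)).const_mul (-3)).add_const (-3))).add
      (((hasDerivAt_log_affine 4 1 x (by linarith)).const_mul 1).add_const 1)).sub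
      (((hasDerivAt_log_affine 8 1 x (by linarith)).const_mul 1).add_const 1)).add hpoly
  · rintro x ⟨hx0, hx1⟩
    have h1 : 0 < 4 + -3 * x := by linarith
    have h2 : 0 < 8 + -3 * x := by linarith
    have h3 : 0 < 4 + 1 * x := by linarith
    have h4 : 0 < 8 + 1 * x := by linarith
    have d1 := div_sub_div_of_eq_add_four (-3) h1.ne' h2.ne' (by ring)
    have d2 := div_sub_div_of_eq_add_four 1 h3.ne' h4.ne' (by ring)
    have hle : (1 + 6 / 5 * x) + 4 / ((4 + 1 * x) * (8 + 1 * x))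
        ≤ 36 / ((4 + -3 * x) * (8 + -3 * x)) := by
      rw [← le_sub_iff_add_le, div_sub_div _ _ (by positivity) (by positivity),
        le_div_iff₀ (by positivity)]
      have p4 : x ^ 4 ≤ x := by simpa using pow_le_pow_of_le_one hx0 hx1 (by norm_num : 1 ≤ 4)
      have p5 : x ^ 5 ≤ x := by simpa using pow_le_pow_of_le_one hx0 hx1 (by norm_num : 1 ≤ 5)
      have p2 : 0 ≤ x ^ 2 := by positivity
      have p3 : 0 ≤ x ^ 3 := by positivity
      linarith
    have e : -(36 / ((4 + -3 * x) * (8 + -3 * x)))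
        = 3 * (4 * -3 / ((4 + -3 * x) * (8 + -3 * x))) := by
      ring
    norm_num only at d1 d2 hle e ⊢
    linarith

theorem entropy_upper_bound : ∀ x ∈ Set.Icc (0 : ℝ) 1,
    4 * Real.log 2 * x - (4 + -3 * x) * Real.log (4 + -3 * x)
      + (8 + -3 * x) * Real.log (8 + -3 * x)
      + (4 + 1 * x) * Real.log (4 + 1 * x) - (8 + 1 * x) * Real.log (8 + 1 * x)
      + (1 / 2 * x ^ 2 + 1 / 5 * x ^ 3) ≤ 0 := by
  refine nonpos_of_hasDerivAt_nonpos ?_ ?_ entropy_deriv_upper_bound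
  · norm_num
  · rintro x ⟨hx0, hx1⟩
    have hpoly : HasDerivAt (fun x : ℝ => 1 / 2 * x ^ 2 + 1 / 5 * x ^ 3)
        (x + 3 / 5 * x ^ 2) x := by
      refine (((hasDerivAt_pow 2 x).const_mul (1 / 2)).add
        ((hasDerivAt_pow 3 x).const_mul (1 / 5))).congr_deriv ?_
      norm_num
      ring
    refine (((((((hasDerivAt_id x).const_mul (4 * Real.log 2)).sub
      (hasDerivAt_mul_log_affine 4 (-3) x (by linarith))).add
      (hasDerivAt_mul_log_affine 8 (-3) x (by linarith))).add
      (hasDerivAt_mul_log_affine 4 1 x (by linarith))).sub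
      (hasDerivAt_mul_log_affine 8 1 x (by linarith))).add hpoly).congr_deriv ?_
    ring


/-- Proposition A.6: with
`f₁(g) = 2g(-2 + ln(4-3g) - ln(8-3g) - ln(g+4) + ln(g+8) - 2 ln 2)` and
`f₂(g) = 4g ln 2 - (4-3g) ln(4-3g) + (8-3g) ln(8-3g) + (4+g) ln(4+g) - (8+g) ln(8+g)`,
for every `g ∈ (0,1)` we have `f₂(g) < 0` and `14/g > 1 + f₁(g)/f₂(g)`. -/
theorem prop_A6 (g : ℝ) (hg0 : 0 < g) (hg1 : g < 1) :
    let f₁ : ℝ := 2 * g * (-2 + Real.log (4 - 3 * g) - Real.log (8 - 3 * g)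
      - Real.log (g + 4) + Real.log (g + 8) - 2 * Real.log 2)
    let f₂ : ℝ := 4 * g * Real.log 2 - (4 - 3 * g) * Real.log (4 - 3 * g)
      + (8 - 3 * g) * Real.log (8 - 3 * g) + (4 + g) * Real.log (4 + g)
      - (8 + g) * Real.log (8 + g)
    f₂ < 0 ∧ 14 / g > 1 + f₁ / f₂ := by
  intro f₁ f₂
  have hg : g ∈ Set.Icc (0 : ℝ) 1 := ⟨hg0.le, hg1.le⟩
  have e1 : 4 + -3 * g = 4 - 3 * g := by ring
  have e2 : 8 + -3 * g = 8 - 3 * g := by ring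
  have hL := log_ratio_lower_bound g hg
  have hE := entropy_upper_bound g hg
  rw [e1, e2, one_mul] at hL hE
  have hf₂ : f₂ ≤ -(1 / 2 * g ^ 2 + 1 / 5 * g ^ 3) := by
    simp only [f₂]
    linarith
  have hf₂_neg : f₂ < 0 := hf₂.trans_lt (neg_lt_zero.2 (by positivity))
  refine ⟨hf₂_neg, ?_⟩
  have hpoly : (14 - g) * (1 / 2 + 1 / 5 * g) >
      2 * (2 + 2 * 0.6931471808 + (1 / 2 * g + 9 / 40 * g ^ 2 + 2 / 5 * g ^ 4)) := by
    have p2 : g ^ 2 ≤ g := by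
      simpa using pow_le_pow_of_le_one hg0.le hg1.le (by norm_num : 1 ≤ 2)
    have p4 : g ^ 4 ≤ g := by
      simpa using pow_le_pow_of_le_one hg0.le hg1.le (by norm_num : 1 ≤ 4)
    linarith
  have hf₁ : f₁ > -(g * ((14 - g) * (1 / 2 + 1 / 5 * g))) := by
    have hlog := Real.log_two_lt_d9
    have : 2 * (-2 + Real.log (4 - 3 * g) - Real.log (8 - 3 * g)
        - Real.log (g + 4) + Real.log (g + 8) - 2 * Real.log 2)
        > -((14 - g) * (1 / 2 + 1 / 5 * g)) := by
      rw [add_comm g 4, add_comm g 8]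
      linarith
    have := mul_lt_mul_of_pos_left this hg0
    simp only [f₁]
    linarith
  have hmul : (14 / g - 1) * f₂ < f₁ := by
    have hc : 0 ≤ 14 / g - 1 := by
      rw [sub_nonneg, le_div_iff₀ hg0]
      linarith
    refine (mul_le_mul_of_nonneg_left hf₂ hc).trans_lt ?_
    have : (14 / g - 1) * -(1 / 2 * g ^ 2 + 1 / 5 * g ^ 3)
        = -(g * ((14 - g) * (1 / 2 + 1 / 5 * g))) := by
      field_simp
    rw [this]
    exact hf₁
  have := (div_lt_iff_of_neg hf₂_neg).2 hmul
  linarith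
end
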